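/- arXiv:1910.03296 — 2 statements merged into one kernel-verified Lean document; each statement's English description precedes it below -/
import Mathlib

section
/- Let n ≥ 1, let U ⊆ ℝⁿ be open and convex, let f : ℝⁿ → ℝⁿ be continuously differentiable on U with Jacobian J_f, let xₙ ∈ U, and let A : ℝⁿ → ℝⁿ be an invertible linear map. Assume: (A1) there is ω > 0 such that for every v ∈ U and every t ∈ [0,1], writing z = t·xₙ + (1−t)·v, one has ‖A⁻¹ (J_f(xₙ) − J_f(z)) (xₙ − v)‖ ≤ ω (1−t) ‖xₙ − v‖²; (A2) there is κ ∈ [0,1) with ‖Id − A⁻¹ J_f(xₙ)‖ ≤ κ; (A3) setting αₙ = ‖A⁻¹ f(xₙ)‖, one has ω αₙ ≤ (1−κ)²/2; (A4) the closed ball of radius R = (1−κ)/ω + √((1−κ)²/ω² − 2αₙ/ω) centered at xₙ is contained in U. Then there exists a point u in the closed ball B_R(xₙ) with f(u) = 0. -/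
open Metric MeasureTheory in
/-- A perturbation of the identity by a map with small Lipschitz constant which fixes the unit
sphere and maps the open unit ball into itself maps the open unit ball onto itself. -/
theorem image_unitBall_eq_of_approximatesLinearOn_id {E : Type*} [NormedAddCommGroup E]
    [NormedSpace ℝ E] [FiniteDimensional ℝ E] [Nontrivial E] {φ : E → E} {c : NNReal} (hc : c < 1)
    (hφ : ApproximatesLinearOn φ (ContinuousLinearEquiv.refl ℝ E : E →L[ℝ] E) (closedBall 0 1) c)
    (hball : Set.MapsTo φ (ball 0 1) (ball 0 1)) (hsphere : ∀ x ∈ sphere (0 : E) 1, φ x = x) :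
    φ '' ball 0 1 = ball 0 1 := by
  have : CompleteSpace E := FiniteDimensional.complete ℝ E
  have hopen : IsOpen (φ '' ball 0 1) := by
    refine (hφ.mono_set ball_subset_closedBall).open_image
      (ContinuousLinearEquiv.refl ℝ E).toNonlinearRightInverse isOpen_ball (Or.inr ?_)
    have : (ContinuousLinearEquiv.refl ℝ E).toNonlinearRightInverse.nnnorm = 1 := by
      change ‖(ContinuousLinearMap.id ℝ E)‖₊ = 1
      simp
    simpa [this] using hc
  refine hball.image_subset.antisymm ?_
  refine (convex_ball (0 : E) 1).isPreconnected.subset_of_closure_inter_subset hopen ?_ ?_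
  · have h0 : φ 0 ∈ ball (0 : E) 1 := hball (mem_ball_self one_pos)
    exact ⟨φ 0, h0, 0, mem_ball_self one_pos, rfl⟩
  · rintro y ⟨hy, hyb⟩
    have hclosed : IsClosed (φ '' closedBall 0 1) :=
      ((isCompact_closedBall 0 1).image_of_continuousOn hφ.continuousOn).isClosed
    obtain ⟨x, hx, rfl⟩ := closure_minimal (Set.image_mono ball_subset_closedBall) hclosed hy
    refine ⟨x, ?_, rfl⟩
    by_contra hxb
    have hxs : x ∈ sphere (0 : E) 1 := by
      simp only [mem_closedBall, mem_ball, mem_sphere, not_lt] at *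
      exact le_antisymm hx hxb
    rw [hsphere x hxs] at hyb
    exact hxb hyb

open Polynomial in
/-- The polynomial `t ↦ det (1 + t • M)` is recovered from its values at `dim E + 1` nodes. -/
theorem ContinuousLinearMap.det_one_add_smul_eq_sum_lagrange {E : Type*} [NormedAddCommGroup E]
    [NormedSpace ℝ E] [FiniteDimensional ℝ E] (M : E →L[ℝ] E) {v : ℕ → ℝ}
    (hv : Function.Injective v) (t : ℝ) :
    (1 + t • M).det = ∑ i ∈ Finset.range (Module.finrank ℝ E + 1),
      (1 + v i • M).det * (Lagrange.basis (Finset.range (Module.finrank ℝ E + 1)) v i).eval t := by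
  classical
  let b := Module.finBasis ℝ E
  let A := LinearMap.toMatrix b b (M : E →ₗ[ℝ] E)
  let P : ℝ[X] := Matrix.det
    ((X : ℝ[X]) • A.map C + (1 : Matrix (Fin (Module.finrank ℝ E)) _ ℝ).map C)
  have hP : ∀ s : ℝ, P.eval s = (1 + s • M).det := by
    intro s
    have h1 : (1 + s • M).det = (LinearMap.toMatrix b b ((1 + s • M : E →L[ℝ] E) : E →ₗ[ℝ] E)).det :=
      (LinearMap.det_toMatrix b _).symm
    have h2 : LinearMap.toMatrix b b ((1 + s • M : E →L[ℝ] E) : E →ₗ[ℝ] E) = s • A + 1 := by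
      have : ((1 + s • M : E →L[ℝ] E) : E →ₗ[ℝ] E) = s • (M : E →ₗ[ℝ] E) + LinearMap.id := by
        ext x; simp [add_comm]
      rw [this, map_add, map_smul, LinearMap.toMatrix_id]
    rw [h1, h2, ← coe_evalRingHom, RingHom.map_det]
    congr 1
    ext i j
    rcases eq_or_ne i j with rfl | hij
    · simp [mul_comm s]
    · simp [hij, mul_comm s]
  have hdeg : P.degree < (Finset.range (Module.finrank ℝ E + 1)).card := by
    refine lt_of_le_of_lt degree_le_natDegree ?_
    have := natDegree_det_X_add_C_le A (1 : Matrix (Fin (Module.finrank ℝ E)) _ ℝ)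
    rw [Fintype.card_fin] at this
    rw [Finset.card_range]
    exact_mod_cast Nat.lt_succ_of_le this
  have := Lagrange.eq_interpolate (hv.injOn (s := ↑(Finset.range (Module.finrank ℝ E + 1)))) hdeg
  rw [← hP, this, Lagrange.interpolate_apply, eval_finsetSum]
  simp [hP]

open Metric MeasureTheory in
/-- There is no `C¹` retraction of the closed unit ball onto the unit sphere. -/
theorem false_of_contDiffAt_retraction {E : Type*} [NormedAddCommGroup E]
    [InnerProductSpace ℝ E] [FiniteDimensional ℝ E] {r : E → E}
    (hr : ∀ x ∈ closedBall (0 : E) 1, ContDiffAt ℝ 1 r x)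
    (hnorm : ∀ x ∈ closedBall (0 : E) 1, ‖r x‖ = 1)
    (hsphere : ∀ x ∈ sphere (0 : E) 1, r x = x) : False := by
  borelize E
  let μ : Measure E := Measure.addHaar
  have : Nontrivial E := ⟨r 0, 0, fun h => by simpa [h] using hnorm 0 (by simp)⟩
  let D : E → E →L[ℝ] E := fun x => fderiv ℝ r x - 1
  have hD : ∀ x ∈ closedBall (0 : E) 1, HasFDerivAt (fun x => r x - x) (D x) x := fun x hx =>
    ((hr x hx).differentiableAt one_ne_zero).hasFDerivAt.sub (hasFDerivAt_id x)
  have hDcont : ContinuousOn D (closedBall 0 1) := fun x hx =>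
    (((hr x hx).continuousAt_fderiv one_ne_zero).sub continuousAt_const).continuousWithinAt
  obtain ⟨K, hK⟩ := (isCompact_closedBall (0 : E) 1).exists_bound_of_continuousOn hDcont
  have hK0 : 0 ≤ K := (norm_nonneg _).trans (hK 0 (by simp))
  have hlip : ∀ x ∈ closedBall (0 : E) 1, ∀ y ∈ closedBall (0 : E) 1,
      ‖(r x - x) - (r y - y)‖ ≤ K * ‖x - y‖ := fun x hx y hy =>
    (convex_closedBall (0 : E) 1).norm_image_sub_le_of_norm_hasFDerivWithin_le
      (fun z hz => (hD z hz).hasFDerivWithinAt) hK hy hx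
  obtain ⟨ε, hε, hdet⟩ : ∃ ε > 0, ∀ M : E →L[ℝ] E, ‖M‖ < ε → 0 < (1 + M).det := by
    have hcont : ContinuousAt (fun M : E →L[ℝ] E => (1 + M).det) 0 :=
      (ContinuousLinearMap.continuous_det.comp (continuous_const.add continuous_id)).continuousAt
    have hpos : (0 : ℝ) < (1 + (0 : E →L[ℝ] E)).det := by
      rw [add_zero]
      have : (1 : E →L[ℝ] E).det = 1 := LinearMap.det_id
      rw [this]; exact one_pos
    obtain ⟨ε, hε, h⟩ := Metric.eventually_nhds_iff.1 (hcont.eventually (lt_mem_nhds hpos))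
    exact ⟨ε, hε, fun M hM => h (by simpa using hM)⟩
  have hvol : ∀ t : ℝ, 0 < t → t < 1 → t * K < 1 → t * K < ε →
      ∫ x in ball (0 : E) 1, (1 + t • D x).det ∂μ = μ.real (ball 0 1) := by
    intro t ht0 ht1 htK htε
    let φ : E → E := fun x => x + t • (r x - x)
    have happ : ApproximatesLinearOn φ (ContinuousLinearEquiv.refl ℝ E : E →L[ℝ] E)
        (closedBall 0 1) ⟨t * K, mul_nonneg ht0.le hK0⟩ := by
      intro x hx y hy
      have h1 : φ x - φ y - (ContinuousLinearEquiv.refl ℝ E : E →L[ℝ] E) (x - y) =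
          t • ((r x - x) - (r y - y)) := by
        simp only [φ, ContinuousLinearEquiv.coe_refl, ContinuousLinearMap.coe_id', id_eq, smul_sub]
        abel
      rw [h1, norm_smul, Real.norm_of_nonneg ht0.le]
      change _ ≤ t * K * _
      rw [mul_assoc]
      exact mul_le_mul_of_nonneg_left (hlip x hx y hy) ht0.le
    have hmaps : Set.MapsTo φ (ball 0 1) (ball 0 1) := by
      intro x hx
      have hrx := hnorm x (ball_subset_closedBall hx)
      rw [mem_ball_zero_iff] at hx ⊢
      have h1 : φ x = (1 - t) • x + t • r x := by simp only [φ, smul_sub, sub_smul, one_smul]; abel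
      calc ‖φ x‖ ≤ ‖(1 - t) • x‖ + ‖t • r x‖ := h1 ▸ norm_add_le _ _
        _ = (1 - t) * ‖x‖ + t := by
          rw [norm_smul, norm_smul, hrx, Real.norm_of_nonneg ht0.le,
            Real.norm_of_nonneg (sub_nonneg.2 ht1.le), mul_one]
        _ < 1 := by nlinarith
    have himage : φ '' ball 0 1 = ball 0 1 :=
      image_unitBall_eq_of_approximatesLinearOn_id (by exact_mod_cast htK) happ hmaps
        fun x hx => by simp [φ, hsphere x hx]
    have hinj : Set.InjOn φ (ball 0 1) := by
      intro x hx y hy hxy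
      have h1 := happ x (ball_subset_closedBall hx) y (ball_subset_closedBall hy)
      rw [hxy] at h1
      have h2 : ‖x - y‖ ≤ t * K * ‖x - y‖ := by
        rw [sub_self, zero_sub, norm_neg] at h1
        exact h1
      by_contra hne
      have := norm_pos_iff.2 (sub_ne_zero.2 hne)
      nlinarith
    have hderiv : ∀ x ∈ ball (0 : E) 1, HasFDerivWithinAt φ (1 + t • D x) (ball 0 1) x :=
      fun x hx => ((hasFDerivAt_id x).add
        ((hD x (ball_subset_closedBall hx)).const_smul t)).hasFDerivWithinAt
    have hcv := integral_image_eq_integral_abs_det_fderiv_smul μ measurableSet_ball hderiv hinj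
      (fun _ => (1 : ℝ))
    rw [himage] at hcv
    simp only [smul_eq_mul, mul_one, integral_const, measureReal_restrict_apply_univ] at hcv
    rw [hcv]
    refine setIntegral_congr_fun measurableSet_ball fun x hx => ?_
    refine (abs_of_pos (hdet _ ?_)).symm
    rw [norm_smul, Real.norm_of_nonneg ht0.le]
    exact (mul_le_mul_of_nonneg_left (hK x (ball_subset_closedBall hx)) ht0.le).trans_lt htε
  have hdet0 : ∀ x ∈ ball (0 : E) 1, (1 + (1 : ℝ) • D x).det = 0 := by
    intro x hx
    have hxc := ball_subset_closedBall hx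
    have h1 : 1 + (1 : ℝ) • D x = fderiv ℝ r x := by simp [D]
    rw [h1]
    by_contra hne
    have hd := ((hr x hxc).differentiableAt one_ne_zero).hasFDerivAt
    have h2 : HasFDerivAt (fun y => inner ℝ (r y) (r y)) (0 : E →L[ℝ] ℝ) x := by
      refine (hasFDerivAt_const (1 : ℝ) x).congr_of_eventuallyEq ?_
      filter_upwards [isOpen_ball.mem_nhds hx] with y hy
      rw [real_inner_self_eq_norm_sq, hnorm y (ball_subset_closedBall hy), one_pow]
    have h3 := (hd.inner ℝ hd).unique h2
    have hsurj : Function.Surjective (fderiv ℝ r x) :=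
      (LinearEquiv.ofIsUnitDet (f := (fderiv ℝ r x : E →ₗ[ℝ] E))
        (v := Module.finBasis ℝ E) (v' := Module.finBasis ℝ E)
        (by rw [LinearMap.det_toMatrix]; exact isUnit_iff_ne_zero.2 hne)).surjective
    obtain ⟨w, hw⟩ := hsurj (r x)
    have h4 := DFunLike.congr_fun h3 w
    simp [fderivInnerCLM_apply, hw, hnorm x hxc] at h4
  obtain ⟨δ, hδ, hδ1, hδK, hδε⟩ : ∃ δ > 0, δ < 1 ∧ δ * K < 1 ∧ δ * K < ε := by
    refine ⟨min 1 ε / (2 * (K + 1)), by positivity, ?_, ?_, ?_⟩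
    · rw [div_lt_iff₀ (by positivity)]
      nlinarith [min_le_left 1 ε]
    · rw [div_mul_eq_mul_div, div_lt_iff₀ (by positivity)]
      nlinarith [min_le_left 1 ε]
    · rw [div_mul_eq_mul_div, div_lt_iff₀ (by positivity)]
      nlinarith [min_le_right 1 ε]
  let v : ℕ → ℝ := fun i => δ / (i + 1)
  have hv : Function.Injective v := by
    intro i j hij
    have hi : ((i : ℝ) + 1) ≠ 0 := by positivity
    have hj : ((j : ℝ) + 1) ≠ 0 := by positivity
    simp only [v] at hij
    rw [div_eq_div_iff hi hj] at hij
    have := mul_left_cancel₀ hδ.ne' hij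
    exact_mod_cast (add_right_cancel this).symm
  have hv0 : ∀ i, 0 < v i := fun i => by positivity
  have hvδ : ∀ i, v i ≤ δ := fun i => div_le_self hδ.le (by simp)
  let s := Finset.range (Module.finrank ℝ E + 1)
  have hint : ∀ i, IntegrableOn (fun x => (1 + v i • D x).det) (ball (0 : E) 1) μ := fun i =>
    (ContinuousOn.integrableOn_compact (isCompact_closedBall 0 1)
      (ContinuousLinearMap.continuous_det.comp_continuousOn
        (continuousOn_const.add (hDcont.const_smul (v i))))).mono_set ball_subset_closedBall
  have hsum : ∫ x in ball (0 : E) 1, (1 + (1 : ℝ) • D x).det ∂μ = μ.real (ball 0 1) := by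
    calc ∫ x in ball (0 : E) 1, (1 + (1 : ℝ) • D x).det ∂μ
        = ∫ x in ball (0 : E) 1,
            ∑ i ∈ s, (1 + v i • D x).det * (Lagrange.basis s v i).eval 1 ∂μ := by
          congr 1; ext x
          exact (D x).det_one_add_smul_eq_sum_lagrange hv 1
      _ = ∑ i ∈ s, μ.real (ball 0 1) * (Lagrange.basis s v i).eval 1 := by
          rw [integral_finsetSum _ fun i _ => (hint i).mul_const _]
          refine Finset.sum_congr rfl fun i _ => ?_
          rw [integral_mul_const, hvol (v i) (hv0 i) ((hvδ i).trans_lt hδ1)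
            ((mul_le_mul_of_nonneg_right (hvδ i) hK0).trans_lt hδK)
            ((mul_le_mul_of_nonneg_right (hvδ i) hK0).trans_lt hδε)]
      _ = μ.real (ball 0 1) := by
          rw [← Finset.mul_sum, ← Polynomial.eval_finsetSum,
            Lagrange.sum_basis hv.injOn (by simp [s]), Polynomial.eval_one, mul_one]
  rw [setIntegral_congr_fun measurableSet_ball hdet0, integral_zero] at hsum
  have : 0 < μ.real (ball (0 : E) 1) :=
    ENNReal.toReal_pos (measure_ball_pos μ 0 one_pos).ne' measure_ball_lt_top.ne
  exact this.ne hsum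

open Metric in
/-- **Brouwer's fixed point theorem** for `C¹` self-maps of the closed unit ball. -/
theorem exists_fixedPoint_unitClosedBall_of_contDiffAt {E : Type*} [NormedAddCommGroup E]
    [InnerProductSpace ℝ E] [FiniteDimensional ℝ E] {g : E → E}
    (hg : ∀ x ∈ closedBall (0 : E) 1, ContDiffAt ℝ 1 g x)
    (hmaps : Set.MapsTo g (closedBall 0 1) (closedBall 0 1)) :
    ∃ x ∈ closedBall (0 : E) 1, g x = x := by
  by_contra! hne
  let w : E → E := fun x => x - g x
  let a : E → ℝ := fun x => inner ℝ (w x) (w x)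
  let b : E → ℝ := fun x => inner ℝ x (w x)
  let q : E → ℝ := fun x => b x * b x + a x * (1 - inner ℝ x x)
  have hapos : ∀ x ∈ closedBall (0 : E) 1, 0 < a x := fun x hx =>
    real_inner_self_pos.2 (sub_ne_zero.2 (hne x hx).symm)
  have hbpos : ∀ x ∈ sphere (0 : E) 1, 0 < b x := by
    intro x hx
    have hxc := sphere_subset_closedBall hx
    have h1 := hapos x hxc
    have h2 : ‖g x‖ ≤ 1 := by simpa using hmaps hxc
    have h3 : ‖x‖ = 1 := by simpa using hx
    have h4 : a x = ‖x‖ ^ 2 - 2 * inner ℝ x (g x) + ‖g x‖ ^ 2 := by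
      rw [← norm_sub_sq_real]; exact real_inner_self_eq_norm_sq _
    have h5 : b x = ‖x‖ ^ 2 - inner ℝ x (g x) := by
      simp only [b, w, inner_sub_right, real_inner_self_eq_norm_sq]
    nlinarith [norm_nonneg (g x)]
  have hqpos : ∀ x ∈ closedBall (0 : E) 1, 0 < q x := by
    intro x hx
    have hx1 : ‖x‖ ≤ 1 := by simpa using hx
    simp only [q, real_inner_self_eq_norm_sq]
    rcases hx1.lt_or_eq with h | h
    · have : 0 < 1 - ‖x‖ ^ 2 := by nlinarith [norm_nonneg x]
      nlinarith [mul_pos (hapos x hx) this, mul_self_nonneg (b x)]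
    · have := hbpos x (by simpa using h)
      rw [h]; nlinarith
  let l : E → ℝ := fun x => (Real.sqrt (q x) - b x) / a x
  refine false_of_contDiffAt_retraction (r := fun x => x + l x • w x) ?_ ?_ ?_
  · intro x hx
    have hw : ContDiffAt ℝ 1 w x := contDiffAt_id.sub (hg x hx)
    have ha : ContDiffAt ℝ 1 a x := hw.inner ℝ hw
    have hb : ContDiffAt ℝ 1 b x := contDiffAt_id.inner ℝ hw
    have hq : ContDiffAt ℝ 1 q x :=
      (hb.mul hb).add (ha.mul (contDiffAt_const.sub (contDiffAt_id.inner ℝ contDiffAt_id)))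
    have hl : ContDiffAt ℝ 1 l x :=
      ((hq.sqrt (hqpos x hx).ne').sub hb).div ha (hapos x hx).ne'
    exact contDiffAt_id.add (hl.smul hw)
  · intro x hx
    have hs := Real.mul_self_sqrt (hqpos x hx).le
    have hl : l x * a x = Real.sqrt (q x) - b x := div_mul_cancel₀ _ (hapos x hx).ne'
    have h1 : ‖x + l x • w x‖ ^ 2 = inner ℝ x x + 2 * l x * b x + l x * l x * a x := by
      rw [← real_inner_self_eq_norm_sq, real_inner_add_add_self]
      simp only [inner_smul_left, inner_smul_right, a, b, RCLike.conj_to_real]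
      ring
    have h2 : a x * ‖x + l x • w x‖ ^ 2 = a x * 1 := by
      rw [h1]
      calc a x * (inner ℝ x x + 2 * l x * b x + l x * l x * a x)
          = a x * inner ℝ x x + 2 * b x * (l x * a x) + (l x * a x) * (l x * a x) := by ring
        _ = a x * inner ℝ x x + (Real.sqrt (q x) * Real.sqrt (q x)) - b x * b x := by
          rw [hl]; ring
        _ = a x * 1 := by rw [hs]; simp only [q]; ring
    have h3 := mul_left_cancel₀ (hapos x hx).ne' h2
    exact (pow_eq_one_iff_of_nonneg (norm_nonneg _) two_ne_zero).1 h3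
  · intro x hx
    have hx1 : ‖x‖ = 1 := by simpa using hx
    have hq : q x = b x * b x := by simp [q, hx1]
    simp [l, hq, Real.sqrt_mul_self (hbpos x hx).le]

open Metric in
/-- **Brouwer's fixed point theorem** for `C¹` self-maps of a closed ball. -/
theorem exists_fixedPoint_closedBall_of_contDiffAt {E : Type*} [NormedAddCommGroup E]
    [InnerProductSpace ℝ E] [FiniteDimensional ℝ E] {g : E → E} {c : E} {R : ℝ} (hR : 0 < R)
    (hg : ∀ x ∈ closedBall c R, ContDiffAt ℝ 1 g x)
    (hmaps : Set.MapsTo g (closedBall c R) (closedBall c R)) :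
    ∃ x ∈ closedBall c R, g x = x := by
  have hmem : ∀ y ∈ closedBall (0 : E) 1, c + R • y ∈ closedBall c R := by
    intro y hy
    have : ‖y‖ ≤ 1 := by simpa using hy
    simpa [norm_smul, abs_of_pos hR] using mul_le_of_le_one_right hR.le this
  obtain ⟨y, hy, hfix⟩ := exists_fixedPoint_unitClosedBall_of_contDiffAt
    (g := fun y => R⁻¹ • (g (c + R • y) - c))
    (fun y hy => by
      have h1 : ContDiffAt ℝ 1 (fun y : E => c + R • y) y := by fun_prop
      exact (((hg _ (hmem y hy)).comp y h1).sub contDiffAt_const).const_smul R⁻¹)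
    (fun y hy => by
      have := hmaps (hmem y hy)
      rw [mem_closedBall, dist_eq_norm] at this
      rw [mem_closedBall_zero_iff, norm_smul, norm_inv, Real.norm_of_nonneg hR.le,
        inv_mul_le_iff₀ hR, mul_one]
      exact this)
  refine ⟨c + R • y, hmem y hy, ?_⟩
  have h1 := congrArg (fun z => c + R • z) hfix
  simpa [smul_smul, hR.ne'] using h1

/-- **Corollary** (a posteriori existence of a zero).
Under the assumptions (A1)--(A4) at the iterate `xn`, there exists a zero `u` of `f`
in the closed ball of radius `R = (1-κ)/ω + √((1-κ)²/ω² - 2αₙ/ω)` around `xn`. -/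
theorem exists_zero_in_ball
    {n : ℕ} (hn : 1 ≤ n)
    (U : Set (EuclideanSpace ℝ (Fin n))) (hUopen : IsOpen U) (hUconv : Convex ℝ U)
    (f : EuclideanSpace ℝ (Fin n) → EuclideanSpace ℝ (Fin n))
    (J : EuclideanSpace ℝ (Fin n) →
      (EuclideanSpace ℝ (Fin n) →L[ℝ] EuclideanSpace ℝ (Fin n)))
    (hf : ∀ x ∈ U, HasFDerivAt f (J x) x)
    (hJcont : ContinuousOn J U)
    (xn : EuclideanSpace ℝ (Fin n)) (hxn : xn ∈ U)
    (A : EuclideanSpace ℝ (Fin n) ≃L[ℝ] EuclideanSpace ℝ (Fin n))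
    (ω κ : ℝ) (hω : 0 < ω) (hκ0 : 0 ≤ κ) (hκ1 : κ < 1)
    (hA1 : ∀ v ∈ U, ∀ t ∈ Set.Icc (0:ℝ) 1,
      ‖A.symm ((J xn - J (t • xn + (1 - t) • v)) (xn - v))‖
        ≤ ω * (1 - t) * ‖xn - v‖ ^ 2)
    (hA2 : ‖ContinuousLinearMap.id ℝ (EuclideanSpace ℝ (Fin n))
        - (A.symm : EuclideanSpace ℝ (Fin n) →L[ℝ] EuclideanSpace ℝ (Fin n)).comp (J xn)‖
        ≤ κ)
    (α : ℝ) (hα : α = ‖A.symm (f xn)‖)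
    (hA3 : ω * α ≤ (1 - κ) ^ 2 / 2)
    (R : ℝ) (hR : R = (1 - κ) / ω + Real.sqrt ((1 - κ) ^ 2 / ω ^ 2 - 2 * α / ω))
    (hA4 : Metric.closedBall xn R ⊆ U) :
    ∃ u ∈ Metric.closedBall xn R, f u = 0 := by
  have hR0 : 0 < R := by
    rw [hR]
    have : 0 < (1 - κ) / ω := div_pos (sub_pos.2 hκ1) hω
    positivity
  have hroot : α + κ * R + ω / 2 * R ^ 2 = R := by
    have hnn : 0 ≤ (1 - κ) ^ 2 / ω ^ 2 - 2 * α / ω := by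
      have : (1 - κ) ^ 2 / ω ^ 2 - 2 * α / ω = 2 / ω ^ 2 * ((1 - κ) ^ 2 / 2 - ω * α) := by
        field_simp
      rw [this]
      exact mul_nonneg (by positivity) (sub_nonneg.2 hA3)
    have h1 : (R - (1 - κ) / ω) ^ 2 = (1 - κ) ^ 2 / ω ^ 2 - 2 * α / ω := by
      rw [hR, add_sub_cancel_left, Real.sq_sqrt hnn]
    field_simp at h1
    have h2 : ω * (2 * (α + κ * R + ω / 2 * R ^ 2 - R)) = 0 := by linear_combination h1
    have h3 := (mul_eq_zero.1 h2).resolve_left hω.ne'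
    linarith
  have hsecond : ∀ v ∈ U, ‖A.symm (f v - f xn - J xn (v - xn))‖ ≤ ω / 2 * ‖v - xn‖ ^ 2 := by
    intro v hv
    have hseg : ∀ s ∈ Set.Icc (0 : ℝ) 1, xn + s • (v - xn) ∈ U := fun s hs =>
      hUconv.add_smul_sub_mem hxn hv hs
    let F : ℝ → EuclideanSpace ℝ (Fin n) := fun s =>
      A.symm (f (xn + s • (v - xn)) - f xn - s • J xn (v - xn))
    have hF : ∀ s ∈ Set.Icc (0 : ℝ) 1, HasDerivAt F
        (A.symm (J (xn + s • (v - xn)) (v - xn) - J xn (v - xn))) s := by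
      intro s hs
      have h1 : HasDerivAt (fun s : ℝ => xn + s • (v - xn)) (v - xn) s := by
        simpa using ((hasDerivAt_id s).smul_const (v - xn)).const_add xn
      have h2 := (hf _ (hseg s hs)).comp_hasDerivAt s h1
      have h3 : HasDerivAt (fun s : ℝ => s • J xn (v - xn)) (J xn (v - xn)) s := by
        simpa using (hasDerivAt_id s).smul_const (J xn (v - xn))
      exact (A.symm : EuclideanSpace ℝ (Fin n) →L[ℝ] EuclideanSpace ℝ (Fin n)).hasFDerivAt
        |>.comp_hasDerivAt s ((h2.sub_const (f xn)).sub h3)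
    have hbound := image_norm_le_of_norm_deriv_right_le_deriv_boundary (f := F) (a := 0) (b := 1)
      (B := fun s => ω / 2 * ‖v - xn‖ ^ 2 * s ^ 2)
      (B' := fun s => ω * s * ‖v - xn‖ ^ 2)
      (fun s hs => (hF s hs).continuousAt.continuousWithinAt)
      (fun s hs => (hF s (Set.Ico_subset_Icc_self hs)).hasDerivWithinAt)
      (by simp [F])
      (fun s => by
        refine ((hasDerivAt_pow 2 s).const_mul (ω / 2 * ‖v - xn‖ ^ 2)).congr_deriv ?_
        push_cast
        ring)
      (fun s hs => by
        have h1 := hA1 v hv (1 - s) ⟨by linarith [hs.2], by linarith [hs.1]⟩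
        have h2 : (1 - s) • xn + (1 - (1 - s)) • v = xn + s • (v - xn) := by module
        rw [h2, sub_sub_cancel, norm_sub_rev xn v] at h1
        refine le_of_eq_of_le (congrArg (fun z => ‖A.symm z‖) ?_) h1
        rw [← neg_sub v xn, map_neg, sub_apply, neg_sub])
      (Set.right_mem_Icc.2 zero_le_one)
    simpa [F] using hbound
  let g : EuclideanSpace ℝ (Fin n) → EuclideanSpace ℝ (Fin n) := fun v => v - A.symm (f v)
  have hfC : ∀ x ∈ U, ContDiffAt ℝ 1 f x := by
    intro x hx
    refine contDiffAt_one_iff.2 ⟨J, U, hUopen.mem_nhds hx, hJcont, hf⟩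
  have hmaps : Set.MapsTo g (Metric.closedBall xn R) (Metric.closedBall xn R) := by
    intro v hv
    have h2 := hsecond v (hA4 hv)
    rw [mem_closedBall_iff_norm] at hv ⊢
    have hdecomp : g v - xn = (ContinuousLinearMap.id ℝ (EuclideanSpace ℝ (Fin n))
        - (A.symm : EuclideanSpace ℝ (Fin n) →L[ℝ] EuclideanSpace ℝ (Fin n)).comp (J xn)) (v - xn)
        - A.symm (f xn) - A.symm (f v - f xn - J xn (v - xn)) := by
      simp [g]
      abel
    have h1 := ContinuousLinearMap.le_of_opNorm_le _ hA2 (v - xn)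
    calc ‖g v - xn‖ ≤ κ * ‖v - xn‖ + α + ω / 2 * ‖v - xn‖ ^ 2 := by
          rw [hdecomp, hα]
          exact (norm_sub_le _ _).trans (add_le_add ((norm_sub_le _ _).trans
            (add_le_add h1 le_rfl)) h2)
      _ ≤ κ * R + α + ω / 2 * R ^ 2 := by gcongr
      _ = R := by linarith
  obtain ⟨u, hu, hfix⟩ := exists_fixedPoint_closedBall_of_contDiffAt hR0
    (fun x hx => contDiffAt_id.sub (A.symm.contDiff.contDiffAt.comp x (hfC x (hA4 hx)))) hmaps
  refine ⟨u, hu, ?_⟩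
  have : A.symm (f u) = 0 := by simpa [g] using hfix
  simpa using this
end

section
/- Let n ≥ 1, let U ⊆ ℝⁿ be open and convex, let f : ℝⁿ → ℝⁿ be continuously differentiable on U with Jacobian J_f, let xₙ ∈ U, and let A : ℝⁿ → ℝⁿ be an invertible linear map. Assume: (A★1) there is ω★ > 0 such that for all x, v ∈ U and every t ∈ [0,1], writing z = t·x + (1−t)·v, one has ‖A⁻¹ (J_f(x) − J_f(z)) (x − v)‖ ≤ ω★ (1−t) ‖x − v‖²; (A★2) there is κ★ ∈ [0,1) such that ‖Id − A⁻¹ J_f(x)‖ ≤ κ★ for all x ∈ U; (A★3) αₙ = ‖A⁻¹ f(xₙ)‖ > 0 and ω★ αₙ ≤ (1−κ★)²/2; (A★4) the closed ball of radius R★ = (1−κ★)/ω★ + √((1−κ★)²/(ω★)² − 2αₙ/ω★) centered at xₙ is contained in U. Then the map g(v) = v − A⁻¹ f(v) is a contraction on B_{R★}(xₙ): there exists a constant L < 1 (in fact L = κ★ + (ω★/2) R★) such that ‖g(x) − g(y)‖ ≤ L ‖x − y‖ for all x, y ∈ B_{R★}(xₙ). -/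
/-- **Second part of Theorem 2**: under the strengthened assumptions (A★1)--(A★4),
the simplified Newton map `g v = v - A⁻¹ (f v)` is a contraction on the closed ball
`B_{R★}(xn)`, with contraction constant `L = κ★ + (ω★/2) R★ < 1`. -/
theorem simplified_newton_is_contraction_on_ball
    {n : ℕ} (hn : 1 ≤ n)
    (U : Set (EuclideanSpace ℝ (Fin n))) (hUopen : IsOpen U) (hUconv : Convex ℝ U)
    (f : EuclideanSpace ℝ (Fin n) → EuclideanSpace ℝ (Fin n))
    (J : EuclideanSpace ℝ (Fin n) →
      (EuclideanSpace ℝ (Fin n) →L[ℝ] EuclideanSpace ℝ (Fin n)))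
    (hf : ∀ x ∈ U, HasFDerivAt f (J x) x)
    (hJcont : ContinuousOn J U)
    (xn : EuclideanSpace ℝ (Fin n)) (hxn : xn ∈ U)
    (A : EuclideanSpace ℝ (Fin n) ≃L[ℝ] EuclideanSpace ℝ (Fin n))
    (ω κ : ℝ) (hω : 0 < ω) (hκ0 : 0 ≤ κ) (hκ1 : κ < 1)
    (hA1 : ∀ x ∈ U, ∀ v ∈ U, ∀ t ∈ Set.Icc (0:ℝ) 1,
      ‖A.symm ((J x - J (t • x + (1 - t) • v)) (x - v))‖
        ≤ ω * (1 - t) * ‖x - v‖ ^ 2)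
    (hA2 : ∀ x ∈ U,
      ‖ContinuousLinearMap.id ℝ (EuclideanSpace ℝ (Fin n))
        - (A.symm : EuclideanSpace ℝ (Fin n) →L[ℝ] EuclideanSpace ℝ (Fin n)).comp (J x)‖
        ≤ κ)
    (α : ℝ) (hα : α = ‖A.symm (f xn)‖) (hαpos : 0 < α)
    (hA3 : ω * α ≤ (1 - κ) ^ 2 / 2)
    (R : ℝ) (hR : R = (1 - κ) / ω + Real.sqrt ((1 - κ) ^ 2 / ω ^ 2 - 2 * α / ω))
    (hA4 : Metric.closedBall xn R ⊆ U) :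
    ∃ L : ℝ, L = κ + ω / 2 * R ∧ L < 1 ∧
      ∀ x ∈ Metric.closedBall xn R, ∀ y ∈ Metric.closedBall xn R,
        ‖(x - A.symm (f x)) - (y - A.symm (f y))‖ ≤ L * ‖x - y‖ := by
  have hd : 0 < (1 - κ) / ω := div_pos (by linarith) hω
  have hsqrt : Real.sqrt ((1 - κ) ^ 2 / ω ^ 2 - 2 * α / ω) < (1 - κ) / ω := by
    rw [Real.sqrt_lt' hd, div_pow]
    have : 0 < 2 * α / ω := by positivity
    linarith
  have hRpos : 0 < R := by
    rw [hR]
    positivity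
  have hRlt : ω * R < 2 * (1 - κ) := by
    calc ω * R < ω * (2 * ((1 - κ) / ω)) := by
          gcongr
          linarith
      _ = 2 * (1 - κ) := by field_simp
  refine ⟨κ + ω / 2 * R, rfl, by linarith, fun x hx y hy => ?_⟩
  -- The derivative bound `hA2` makes the Newton map `κ`-Lipschitz on the convex set `U`.
  have hlip : ‖(x - A.symm (f x)) - (y - A.symm (f y))‖ ≤ κ * ‖x - y‖ :=
    hUconv.norm_image_sub_le_of_norm_hasFDerivWithin_le
      (f := fun v => v - A.symm (f v))
      (fun v hv => ((hasFDerivAt_id v).sub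
        (A.symm.hasFDerivAt.comp v (hf v hv))).hasFDerivWithinAt)
      hA2 (hA4 hy) (hA4 hx)
  have hκL : κ ≤ κ + ω / 2 * R := le_add_of_nonneg_right (by positivity)
  exact hlip.trans (by gcongr)
end
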